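/- Let r > 1 be an integer and let G be a finite connected simple graph that is K_r-free and P_5-free (contains no induced subgraph isomorphic to the complete graph K_r nor to the path on 5 vertices). Then for every finite simple graph H, γ(G □ H) ≥ ((r−1)/(2r−3))·γ(G)·γ(H). -/

import Mathlib

open SimpleGraph Finset

/-- `S` is a dominating set of `G`: every vertex is in `S` or adjacent to a vertex of `S`. -/
def IsDomSet {V : Type*} (G : SimpleGraph V) (S : Finset V) : Prop :=
  ∀ v : V, v ∈ S ∨ ∃ u ∈ S, G.Adj u v

/-- The domination number of a finite graph. -/
noncomputable def domNum {V : Type*} [Fintype V] (G : SimpleGraph V) : ℕ :=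
  sInf {n | ∃ S : Finset V, S.card = n ∧ IsDomSet G S}

/-- `G` is `H`-free: `G` has no induced subgraph isomorphic to `H`,
equivalently there is no graph embedding of `H` into `G`. -/
def IsFree {V W : Type*} (G : SimpleGraph V) (H : SimpleGraph W) : Prop :=
  ¬ Nonempty (H ↪g G)

section
variable {V W : Type*}

theorem exists_isDomSet_card_eq_domNum [Fintype V] (G : SimpleGraph V) :
    ∃ S : Finset V, S.card = domNum G ∧ IsDomSet G S :=
  Nat.sInf_mem (s := {n | ∃ S : Finset V, S.card = n ∧ IsDomSet G S})
    ⟨_, Finset.univ, rfl, fun v => Or.inl (Finset.mem_univ v)⟩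

theorem IsDomSet.domNum_le [Fintype V] {G : SimpleGraph V} {S : Finset V} (hS : IsDomSet G S) :
    domNum G ≤ S.card :=
  Nat.sInf_le ⟨S, rfl, hS⟩

open Classical in
/-- The elements of `S` lying over `v`, projected to the second factor. -/
noncomputable def fiberSnd (S : Finset (V × W)) (v : V) : Finset W :=
  {s ∈ S | s.1 = v}.image Prod.snd

theorem mem_fiberSnd {S : Finset (V × W)} {v : V} {w : W} : w ∈ fiberSnd S v ↔ (v, w) ∈ S := by
  simp [fiberSnd]

theorem sum_card_filter_fiberSnd [Fintype V] (S : Finset (V × W)) (p : W → Prop)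
    [DecidablePred p] :
    ∑ v, #{w ∈ fiberSnd S v | p w} = #{s ∈ S | p s.2} := by
  classical
  rw [Finset.card_eq_sum_card_fiberwise (f := Prod.fst) (t := Finset.univ) (by simp)]
  refine Finset.sum_congr rfl fun v _ => ?_
  refine Finset.card_bij' (fun w _ => (v, w)) (fun s _ => s.2) ?_ ?_ ?_ ?_
  · simp +contextual [mem_fiberSnd]
  · rintro ⟨a, b⟩ h
    simp only [Finset.mem_filter, mem_fiberSnd] at h ⊢
    obtain ⟨h, rfl⟩ := h
    exact h
  · simp
  · rintro ⟨a, b⟩ h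
    simp only [Finset.mem_filter] at h
    simp [h.2]

/-- A dominating set contained in `T` of least size among these, with a retraction onto it that
sends every vertex to one of its dominators. -/
theorem exists_minimal_isDomSet_subset {H : SimpleGraph W} {T : Finset W} (hT : IsDomSet H T) :
    ∃ D ⊆ T, (∀ D' ⊆ T, IsDomSet H D' → #D ≤ #D') ∧
      ∃ f : W → W, (∀ w, f w ∈ D) ∧ (∀ w, f w = w ∨ H.Adj (f w) w) ∧ ∀ w ∈ D, f w = w := by
  classical
  obtain ⟨D, hD, hmin⟩ := Finset.exists_min_image {D ∈ T.powerset | IsDomSet H D} Finset.card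
    ⟨T, by simpa using hT⟩
  simp only [Finset.mem_filter, Finset.mem_powerset, and_imp] at hD hmin
  refine ⟨D, hD.1, hmin, ?_⟩
  have key : ∀ w, ∃ d ∈ D, (d = w ∨ H.Adj d w) ∧ (w ∈ D → d = w) := by
    intro w
    by_cases hw : w ∈ D
    · exact ⟨w, hw, Or.inl rfl, fun _ => rfl⟩
    · obtain h | ⟨u, hu, huw⟩ := hD.2 w
      · exact absurd h hw
      · exact ⟨u, hu, Or.inr huw, fun h => absurd h hw⟩
  choose f hfD hf hfix using key
  exact ⟨f, hfD, hf, hfix⟩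

theorem domNum_mul_domNum_succ_le [Fintype V] [Fintype W] [Nonempty V] (G : SimpleGraph V)
    (H : SimpleGraph W) :
    domNum H * (domNum G + 1) ≤ 2 * domNum (G □ H) := by
  classical
  obtain ⟨S, hScard, hS⟩ := exists_isDomSet_card_eq_domNum (G □ H)
  rw [← hScard]
  have hT : IsDomSet H (S.image Prod.snd) := by
    intro w
    obtain ⟨v⟩ := ‹Nonempty V›
    obtain h | ⟨⟨v', w'⟩, h, hadj⟩ := hS (v, w)
    · exact Or.inl (Finset.mem_image_of_mem Prod.snd h)
    · have hw' := Finset.mem_image_of_mem Prod.snd h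
      rw [boxProd_adj] at hadj
      obtain ⟨_, rfl⟩ | ⟨h2, _⟩ := hadj
      · exact Or.inl hw'
      · exact Or.inr ⟨w', hw', h2⟩
  obtain ⟨D, hDT, hmin, f, hfD, hf, hfix⟩ := exists_minimal_isDomSet_subset hT
  have hDdom : IsDomSet H D := fun w => (hf w).elim (fun h => Or.inl (h ▸ hfD w))
    fun h => Or.inr ⟨f w, hfD w, h⟩
  let P : W → Finset V := fun d => {s ∈ S | f s.2 = d}.image Prod.fst
  let M : W → Finset V := fun d => {v | ¬ (v ∈ P d ∨ ∃ u ∈ P d, G.Adj u v)}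
  have hPM : ∀ d, domNum G ≤ #{s ∈ S | f s.2 = d} + #(M d) := by
    intro d
    have hdom : IsDomSet G (P d ∪ M d) := by
      intro v
      by_cases hv : v ∈ P d ∨ ∃ u ∈ P d, G.Adj u v
      · obtain h | ⟨u, hu, h⟩ := hv
        · exact Or.inl (Finset.mem_union_left _ h)
        · exact Or.inr ⟨u, Finset.mem_union_left _ hu, h⟩
      · exact Or.inl (Finset.mem_union_right _ (by simpa [M] using hv))
    calc domNum G ≤ #(P d ∪ M d) := hdom.domNum_le
      _ ≤ #(P d) + #(M d) := Finset.card_union_le _ _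
      _ ≤ _ := Nat.add_le_add_right Finset.card_image_le _
  have hfiber : ∀ v, #{d ∈ D | v ∈ M d} + #{w ∈ fiberSnd S v | w ∈ D} ≤ #(fiberSnd S v) := by
    intro v
    let E : Finset W := {w ∈ fiberSnd S v | w ∉ D} ∪ {d ∈ D | v ∉ M d}
    have hfib : ∀ w ∈ fiberSnd S v, w ∈ E := by
      intro w hw
      by_cases hwD : w ∈ D
      · refine Finset.mem_union_right _ (Finset.mem_filter.2 ⟨hwD, ?_⟩)
        have : v ∈ P w := Finset.mem_image.2
          ⟨(v, w), Finset.mem_filter.2 ⟨mem_fiberSnd.1 hw, hfix w hwD⟩, rfl⟩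
        simp [M, this]
      · exact Finset.mem_union_left _ (Finset.mem_filter.2 ⟨hw, hwD⟩)
    have hET : E ⊆ S.image Prod.snd := by
      intro w hw
      obtain h | h := Finset.mem_union.1 hw
      · exact Finset.mem_image.2 ⟨(v, w), mem_fiberSnd.1 (Finset.mem_filter.1 h).1, rfl⟩
      · exact hDT (Finset.mem_filter.1 h).1
    have hEdom : IsDomSet H E := by
      intro w
      by_cases hM : v ∈ M (f w)
      · have hM' : ¬ (v ∈ P (f w) ∨ ∃ u ∈ P (f w), G.Adj u v) := by simpa [M] using hM
        obtain h | ⟨⟨v', w'⟩, h, hadj⟩ := hS (v, w)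
        · exact Or.inl (hfib w (mem_fiberSnd.2 h))
        · rw [boxProd_adj] at hadj
          obtain ⟨h1, rfl⟩ | ⟨h2, rfl⟩ := hadj
          · exact absurd (Or.inr ⟨v', Finset.mem_image.2
              ⟨(v', w'), Finset.mem_filter.2 ⟨h, rfl⟩, rfl⟩, h1⟩) hM'
          · exact Or.inr ⟨w', hfib w' (mem_fiberSnd.2 h), h2⟩
      · have hE : f w ∈ E :=
          Finset.mem_union_right _ (Finset.mem_filter.2 ⟨hfD w, hM⟩)
        exact (hf w).elim (fun h => Or.inl (h ▸ hE)) fun h => Or.inr ⟨_, hE, h⟩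
    have h1 := (hmin E hET hEdom).trans (Finset.card_union_le _ _)
    have h2 := Finset.card_filter_add_card_filter_not (s := D) (fun d => v ∈ M d)
    have h3 := Finset.card_filter_add_card_filter_not (s := fiberSnd S v) (fun w => w ∈ D)
    omega
  have hsum := Finset.sum_le_sum fun v (_ : v ∈ Finset.univ) => hfiber v
  have hfull := sum_card_filter_fiberSnd S fun _ => True
  simp only [Finset.filter_true] at hfull
  rw [Finset.sum_add_distrib, sum_card_filter_fiberSnd, hfull] at hsum
  have hdouble : ∑ v, #{d ∈ D | v ∈ M d} = ∑ d ∈ D, #(M d) := by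
    have := Finset.sum_card_bipartiteAbove_eq_sum_card_bipartiteBelow
      (s := (Finset.univ : Finset V)) (t := D) (fun v d => v ∈ M d)
    simpa [Finset.bipartiteAbove, Finset.bipartiteBelow] using this
  have hS' : ∑ d ∈ D, #{s ∈ S | f s.2 = d} = #S :=
    (Finset.card_eq_sum_card_fiberwise fun s _ => hfD s.2).symm
  have hD' : #D * domNum G ≤ #S + ∑ d ∈ D, #(M d) := by
    rw [← hS', ← Finset.sum_add_distrib, ← smul_eq_mul]
    exact Finset.card_nsmul_le_sum _ _ _ fun d _ => hPM d
  have hDS : #D ≤ #{s ∈ S | s.2 ∈ D} := by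
    refine (Finset.card_le_card fun d hd => ?_).trans (Finset.card_image_le (f := Prod.snd))
    obtain ⟨s, hs, rfl⟩ := Finset.mem_image.1 (hDT hd)
    exact Finset.mem_image_of_mem _ (Finset.mem_filter.2 ⟨hs, hd⟩)
  calc domNum H * (domNum G + 1) ≤ #D * (domNum G + 1) :=
        Nat.mul_le_mul_right _ hDdom.domNum_le
    _ ≤ 2 * #S := by rw [mul_add_one]; omega

end

section
variable {V : Type*}

theorem isFree_pathGraph_five_not_induced {G : SimpleGraph V} (hP5 : IsFree G (pathGraph 5))
    {a b c d e : V} (hab : G.Adj a b) (hbc : G.Adj b c) (hcd : G.Adj c d) (hde : G.Adj d e)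
    (hac : ¬ G.Adj a c) (had : ¬ G.Adj a d) (hae : ¬ G.Adj a e) (hbd : ¬ G.Adj b d)
    (hbe : ¬ G.Adj b e) (hce : ¬ G.Adj c e) : False := by
  have key : ∀ i j : Fin 5, G.Adj (![a, b, c, d, e] i) (![a, b, c, d, e] j) ↔
      (pathGraph 5).Adj i j := by
    intro i j
    fin_cases i <;> fin_cases j <;>
      simp [pathGraph_adj, hab, hbc, hcd, hde, hac, had, hae, hbd, hbe, hce, hab.symm, hbc.symm,
        hcd.symm, hde.symm, G.adj_comm c a, G.adj_comm d a, G.adj_comm e a, G.adj_comm d b,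
        G.adj_comm e b, G.adj_comm e c]
  refine hP5 ⟨⟨⟨![a, b, c, d, e], fun i j hij => ?_⟩, fun {i j} => key i j⟩⟩
  have hsep : ∀ i j : Fin 5, (∀ k, (pathGraph 5).Adj i k ↔ (pathGraph 5).Adj j k) → i = j := by
    simp only [pathGraph_adj]
    decide
  exact hsep i j fun k => by rw [← key, ← key, hij]

theorem IsFree.card_lt_of_isClique {G : SimpleGraph V} {r : ℕ}
    (hKr : IsFree G (⊤ : SimpleGraph (Fin r))) {K : Finset V} (hK : G.IsClique K) : #K < r := by
  by_contra! hle
  obtain ⟨K', hK', rfl⟩ := Finset.exists_subset_card_eq hle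
  exact hKr ⟨topEmbeddingOfNotCliqueFree fun hfree =>
    hfree K' ⟨hK.subset (Finset.coe_subset.2 hK'), rfl⟩⟩

/-- The graph on the same vertices that keeps only the edges of `G` inside `D`. -/
def edgesWithin (G : SimpleGraph V) (D : Finset V) : SimpleGraph V where
  Adj a b := G.Adj a b ∧ a ∈ D ∧ b ∈ D
  symm := ⟨fun _ _ h => ⟨h.1.symm, h.2.2, h.2.1⟩⟩
  loopless := ⟨fun a h => G.loopless.irrefl a h.1⟩

/-- `D` is a dominating set whose members are joined to each other by walks inside `D`. -/
structure IsConnDomSet (G : SimpleGraph V) (D : Finset V) : Prop where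
  reachable : ∀ x ∈ D, ∀ y ∈ D, (edgesWithin G D).Reachable x y
  isDomSet : IsDomSet G D

/-- `x'` is a neighbour of `x` outside `D` with no other neighbour in `D`. -/
structure IsPrivateNeighbor (G : SimpleGraph V) (D : Finset V) (x x' : V) : Prop where
  not_mem : x' ∉ D
  adj : G.Adj x x'
  eq_of_adj : ∀ y ∈ D, G.Adj y x' → y = x

theorem IsPrivateNeighbor.not_adj {G : SimpleGraph V} {D : Finset V} {x x' y : V}
    (h : IsPrivateNeighbor G D x x') (hy : y ∈ D) (hyx : y ≠ x) : ¬ G.Adj y x' :=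
  fun hadj => hyx (h.eq_of_adj y hy hadj)

theorem exists_minimal_isConnDomSet [Fintype V] {G : SimpleGraph V} (hconn : G.Connected) :
    ∃ D, IsConnDomSet G D ∧ ∀ D', IsConnDomSet G D' → #D ≤ #D' := by
  classical
  have huniv : IsConnDomSet G Finset.univ := by
    refine ⟨fun x _ y _ => (hconn x y).mono fun a b h => ?_, fun v => Or.inl (Finset.mem_univ v)⟩
    exact ⟨h, Finset.mem_univ a, Finset.mem_univ b⟩
  obtain ⟨D, hD, hmin⟩ := Finset.exists_min_image
    ({D | IsConnDomSet G D} : Finset (Finset V)) Finset.card ⟨_, by simpa using huniv⟩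
  simp only [Finset.mem_filter, Finset.mem_univ, true_and] at hD hmin
  exact ⟨D, hD, hmin⟩

theorem exists_isPrivateNeighbor [DecidableEq V] {G : SimpleGraph V} {D : Finset V}
    (hD : IsConnDomSet G D) (hmin : ∀ D', IsConnDomSet G D' → #D ≤ #D') {x y : V} (hx : x ∈ D)
    (hy : y ∈ D) (hyx : G.Adj y x)
    (herase : ∀ z ∈ D, z ≠ x → (edgesWithin G (D.erase x)).Reachable y z) :
    ∃ x', IsPrivateNeighbor G D x x' := by
  have hnot : ¬ IsDomSet G (D.erase x) := by
    intro hdom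
    have hle := hmin (D.erase x) ⟨fun a ha b hb =>
      ((herase a (Finset.mem_of_mem_erase ha) (Finset.ne_of_mem_erase ha)).symm).trans
        (herase b (Finset.mem_of_mem_erase hb) (Finset.ne_of_mem_erase hb)), hdom⟩
    exact absurd (Finset.card_erase_lt_of_mem hx) (not_lt.2 hle)
  simp only [IsDomSet, not_forall, not_or, not_exists, not_and] at hnot
  obtain ⟨v, hv, hv'⟩ := hnot
  have hvx : v ≠ x := by
    rintro rfl
    exact hv' y (Finset.mem_erase.2 ⟨hyx.ne, hy⟩) hyx
  have hvD : v ∉ D := fun h => hv (Finset.mem_erase.2 ⟨hvx, h⟩)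
  have heq : ∀ u ∈ D, G.Adj u v → u = x := fun u hu huv => by
    by_contra hne
    exact hv' u (Finset.mem_erase.2 ⟨hne, hu⟩) huv
  obtain h | ⟨u, hu, huv⟩ := hD.isDomSet v
  · exact absurd h hvD
  · obtain rfl := heq u hu huv
    exact ⟨v, hvD, huv, heq⟩

theorem SimpleGraph.exists_adj_dist_eq_of_dist_eq_add_one {G : SimpleGraph V} {c x : V} {n : ℕ}
    (h : G.dist c x = n + 1) : ∃ p, G.Adj p x ∧ G.dist c p = n := by
  have hreach : G.Reachable c x := Reachable.of_dist_ne_zero (by omega)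
  obtain ⟨w, hw⟩ := hreach.symm.exists_walk_length_eq_dist
  rw [SimpleGraph.dist_comm, h] at hw
  cases w with
  | nil => simp at hw
  | @cons _ p _ hadj q =>
    rw [Walk.length_cons] at hw
    have h1 : G.dist c p ≤ q.length := by
      rw [SimpleGraph.dist_comm]; exact dist_le q
    have h2 := hadj.diff_dist_adj (u := c)
    exact ⟨p, hadj.symm, by omega⟩

/-- In a smallest connected dominating set of a `P₅`-free graph, any two members are at distance
at most two. -/
theorem exists_common_neighbor {G : SimpleGraph V} (hP5 : IsFree G (pathGraph 5)) {D : Finset V}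
    (hD : IsConnDomSet G D) (hmin : ∀ D', IsConnDomSet G D' → #D ≤ #D') {c y : V} (hc : c ∈ D)
    (hy : y ∈ D) : c = y ∨ G.Adj c y ∨ ∃ m ∈ D, G.Adj c m ∧ G.Adj m y := by
  classical
  obtain ⟨x, hx, hmax⟩ := Finset.exists_max_image D ((edgesWithin G D).dist c) ⟨c, hc⟩
  have hle : (edgesWithin G D).dist c x ≤ 2 := by
    by_contra! hlt
    obtain ⟨n, hn⟩ : ∃ n, (edgesWithin G D).dist c x = n + 1 + 1 + 1 :=
      ⟨(edgesWithin G D).dist c x - 3, by omega⟩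
    obtain ⟨p, hpx, hp⟩ := SimpleGraph.exists_adj_dist_eq_of_dist_eq_add_one hn
    obtain ⟨q, hqp, hq⟩ := SimpleGraph.exists_adj_dist_eq_of_dist_eq_add_one hp
    obtain ⟨s, hsq, hs⟩ := SimpleGraph.exists_adj_dist_eq_of_dist_eq_add_one hq
    have hcx : c ≠ x := by
      rintro rfl
      simp at hn
    have herase : ∀ k, ∀ z ∈ D, z ≠ x → (edgesWithin G D).dist c z = k →
        (edgesWithin G (D.erase x)).Reachable c z := by
      intro k
      induction k with
      | zero =>
        intro z hz _ h
        rw [(hD.reachable c hc z hz).dist_eq_zero_iff] at h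
        rw [h]
      | succ k ih =>
        intro z hz hzx h
        obtain ⟨t, htz, ht⟩ := SimpleGraph.exists_adj_dist_eq_of_dist_eq_add_one h
        have htx : t ≠ x := by
          rintro rfl
          have := hmax z hz
          omega
        refine (ih t htz.2.1 htx ht).trans (Adj.reachable ?_)
        exact ⟨htz.1, Finset.mem_erase.2 ⟨htx, htz.2.1⟩, Finset.mem_erase.2 ⟨hzx, hz⟩⟩
    have hpxne : p ≠ x := hpx.1.ne
    obtain ⟨x', hx'⟩ := exists_isPrivateNeighbor hD hmin hx hpx.2.1 hpx.1 fun z hz hzx =>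
      (herase _ p hpx.2.1 hpxne rfl).symm.trans (herase _ z hz hzx rfl)
    have hfar : ∀ a b, a ∈ D → b ∈ D →
        (edgesWithin G D).dist c b + 1 < (edgesWithin G D).dist c a → ¬ G.Adj a b := by
      intro a b ha hb hlt hadj
      have := (show (edgesWithin G D).Adj a b from ⟨hadj, ha, hb⟩).diff_dist_adj (u := c)
      omega
    have hne : ∀ a, (edgesWithin G D).dist c a < (edgesWithin G D).dist c x → a ≠ x := by
      rintro a h rfl
      exact lt_irrefl _ h
    refine isFree_pathGraph_five_not_induced hP5 hx'.adj.symm hpx.1.symm hqp.1.symm hsq.1.symm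
      (fun h => hx'.not_adj hpx.2.1 hpxne h.symm)
      (fun h => hx'.not_adj hqp.2.1 (hne q (by omega)) h.symm)
      (fun h => hx'.not_adj hsq.2.1 (hne s (by omega)) h.symm)
      (hfar x q hx hqp.2.1 (by omega)) (hfar x s hx hsq.2.1 (by omega))
      (hfar p s hpx.2.1 hsq.2.1 (by omega))
  have hcy := (hmax y hy).trans hle
  obtain h | h | h : (edgesWithin G D).dist c y = 0 ∨ (edgesWithin G D).dist c y = 0 + 1 ∨
      (edgesWithin G D).dist c y = 0 + 1 + 1 := by omega
  · exact Or.inl ((hD.reachable c hc y hy).dist_eq_zero_iff.1 h)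
  · exact Or.inr (Or.inl (dist_eq_one_iff_adj.1 h).1)
  · obtain ⟨m, hmy, hm⟩ := SimpleGraph.exists_adj_dist_eq_of_dist_eq_add_one h
    exact Or.inr (Or.inr ⟨m, hmy.2.1, (dist_eq_one_iff_adj.1 hm).1, hmy.1⟩)

theorem exists_isPrivateNeighbor_of_not_adj {G : SimpleGraph V} (hP5 : IsFree G (pathGraph 5))
    {D : Finset V} (hD : IsConnDomSet G D) (hmin : ∀ D', IsConnDomSet G D' → #D ≤ #D') {x t : V}
    (hx : x ∈ D) (ht : t ∈ D) (htx : t ≠ x) (hadj : ¬ G.Adj t x) :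
    ∃ x', IsPrivateNeighbor G D x x' := by
  classical
  have herase : ∀ z ∈ D, z ≠ x → (edgesWithin G (D.erase x)).Reachable t z := by
    have hstep : ∀ a b, a ∈ D → b ∈ D → a ≠ x → b ≠ x → G.Adj a b →
        (edgesWithin G (D.erase x)).Reachable a b := fun a b ha hb hax hbx h =>
      Adj.reachable ⟨h, Finset.mem_erase.2 ⟨hax, ha⟩, Finset.mem_erase.2 ⟨hbx, hb⟩⟩
    intro z hz hzx
    obtain rfl | h | ⟨m, hm, htm, hmz⟩ := exists_common_neighbor hP5 hD hmin ht hz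
    · exact Reachable.rfl
    · exact hstep t z ht hz htx hzx h
    · have hmx : m ≠ x := by
        rintro rfl
        exact hadj htm
      exact (hstep t m ht hm htx hmx htm).trans (hstep m z hm hz hmx hzx hmz)
  obtain h | h | ⟨m, hm, htm, hmx⟩ := exists_common_neighbor hP5 hD hmin ht hx
  · exact absurd h htx
  · exact absurd h hadj
  · exact exists_isPrivateNeighbor hD hmin hx hm hmx fun z hz hzx =>
      (herase m hm hmx.ne).symm.trans (herase z hz hzx)

theorem exists_isPrivateNeighbor_of_universal {G : SimpleGraph V}
    {D : Finset V} (hD : IsConnDomSet G D) (hmin : ∀ D', IsConnDomSet G D' → #D ≤ #D') {c x : V}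
    (hc : c ∈ D) (huniv : ∀ y ∈ D, y ≠ c → G.Adj c y) (hx : x ∈ D) (hxc : x ≠ c) :
    ∃ x', IsPrivateNeighbor G D x x' := by
  classical
  refine exists_isPrivateNeighbor hD hmin hx hc (huniv x hx hxc) fun z hz hzx => ?_
  by_cases hzc : z = c
  · rw [hzc]
  · exact Adj.reachable ⟨huniv z hz hzc, Finset.mem_erase.2 ⟨hxc.symm, hc⟩,
      Finset.mem_erase.2 ⟨hzx, hz⟩⟩

/-- Any two vertices of `D` are at distance at most two within `D`, and `p` assigns a private
neighbour to every vertex of `D' ⊆ D`. -/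
structure IsPrivateSystem (G : SimpleGraph V) (D D' : Finset V) (p : V → V) : Prop where
  diam : ∀ x ∈ D, ∀ y ∈ D, x = y ∨ G.Adj x y ∨ ∃ m ∈ D, G.Adj x m ∧ G.Adj m y
  subset : D' ⊆ D
  isPrivate : ∀ x ∈ D', IsPrivateNeighbor G D x (p x)

namespace IsPrivateSystem

variable {G : SimpleGraph V} {D D' : Finset V} {p : V → V}

theorem adj_of_not_adj (hP5 : IsFree G (pathGraph 5)) (h : IsPrivateSystem G D D' p) {x y : V}
    (hx : x ∈ D') (hy : y ∈ D') (hxy : x ≠ y) (hadj : ¬ G.Adj x y) : G.Adj (p x) (p y) := by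
  by_contra hp
  have hxD := h.subset hx
  have hyD := h.subset hy
  obtain h1 | h1 | ⟨m, hm, hxm, hmy⟩ := h.diam x hxD y hyD
  · exact hxy h1
  · exact hadj h1
  · have px := h.isPrivate x hx
    have py := h.isPrivate y hy
    exact isFree_pathGraph_five_not_induced hP5 px.adj.symm hxm hmy py.adj
      (fun e => px.not_adj hm hxm.ne' e.symm) (fun e => px.not_adj hyD hxy.symm e.symm) hp hadj
      (py.not_adj hxD hxy) (py.not_adj hm hmy.ne)

theorem adj_or_adj (hP5 : IsFree G (pathGraph 5)) (h : IsPrivateSystem G D D' p) {x y z : V}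
    (hx : x ∈ D) (hy : y ∈ D') (hz : z ∈ D') (hxy : G.Adj x y) (hzx : z ≠ x) (hzy : z ≠ y) :
    G.Adj x z ∨ G.Adj y z := by
  by_contra! hn
  have py := h.isPrivate y hy
  have pz := h.isPrivate z hz
  exact isFree_pathGraph_five_not_induced hP5 hxy py.adj
    (h.adj_of_not_adj hP5 hy hz hzy.symm hn.2) pz.adj.symm
    (py.not_adj hx hxy.ne) (pz.not_adj hx hzx.symm) hn.1 (pz.not_adj (h.subset hy) hzy.symm) hn.2
    (fun e => py.not_adj (h.subset hz) hzy e.symm)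

theorem eq_of_not_adj (hP5 : IsFree G (pathGraph 5)) (h : IsPrivateSystem G D D' p) {x z u w : V}
    (hx : x ∈ D') (hz : z ∈ D') (hu : u ∈ D') (hxz : ¬ G.Adj (p x) (p z)) (hne : x ≠ z)
    (hux : G.Adj (p u) (p x)) (huz : G.Adj (p z) (p u)) (hw : w ∈ D) (hxw : G.Adj x w)
    (hwu : w ≠ u) (hux' : u ≠ x) : w = z := by
  by_contra hwz
  have px := h.isPrivate x hx
  have pz := h.isPrivate z hz
  have pu := h.isPrivate u hu
  have hxD := h.subset hx
  exact isFree_pathGraph_five_not_induced hP5 huz hux px.adj.symm hxw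
    (fun e => hxz e.symm) (fun e => pz.not_adj hxD hne e.symm)
    (fun e => pz.not_adj hw hwz e.symm) (fun e => pu.not_adj hxD hux'.symm e.symm)
    (fun e => pu.not_adj hw hwu e.symm) (fun e => px.not_adj hw hxw.ne' e.symm)

/-- If the private neighbours of `x` and `z` are not adjacent, then a vertex not adjacent to `x`
forces `z` to be the only neighbour of `x`. -/
theorem eq_of_adj_of_not_adj (hP5 : IsFree G (pathGraph 5)) (h : IsPrivateSystem G D D' p)
    {x z u w : V} (hx : x ∈ D') (hz : z ∈ D') (hu : u ∈ D') (hxz : ¬ G.Adj (p x) (p z))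
    (hne : x ≠ z) (hux : u ≠ x) (hadj : ¬ G.Adj u x) (hw : w ∈ D) (hxw : G.Adj x w) : w = z := by
  have hpux := h.adj_of_not_adj hP5 hu hx hux hadj
  have hxz' : G.Adj x z := by
    by_contra hn
    exact hxz (h.adj_of_not_adj hP5 hx hz hne hn)
  have huz : u ≠ z := by
    rintro rfl
    exact hadj hxz'.symm
  have hwu : w ≠ u := by
    rintro rfl
    exact hadj hxw.symm
  by_cases hpuz : G.Adj (p z) (p u)
  · exact h.eq_of_not_adj hP5 hx hz hu hxz hne hpux hpuz hw hxw hwu hux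
  · have px := h.isPrivate x hx
    have pz := h.isPrivate z hz
    have pu := h.isPrivate u hu
    exact (isFree_pathGraph_five_not_induced hP5 hpux px.adj.symm hxz' pz.adj
      (fun e => pu.not_adj (h.subset hx) hux.symm e.symm)
      (fun e => pu.not_adj (h.subset hz) huz.symm e.symm)
      (fun e => hpuz e.symm) (fun e => px.not_adj (h.subset hz) hne.symm e.symm) hxz
      (pz.not_adj (h.subset hx) hne)).elim

theorem card_lt (h : IsPrivateSystem G D D' p) {r : ℕ}
    (hKr : IsFree G (⊤ : SimpleGraph (Fin r)))
    (hclique : ∀ x ∈ D', ∀ y ∈ D', x ≠ y → G.Adj (p x) (p y)) : #D' < r := by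
  classical
  have hinj : Set.InjOn p D' := fun x hx y hy hxy =>
    (h.isPrivate y hy).eq_of_adj x (h.subset hx) (hxy ▸ (h.isPrivate x hx).adj)
  rw [← Finset.card_image_of_injOn hinj]
  refine hKr.card_lt_of_isClique ?_
  rintro a ha b hb hab
  obtain ⟨x, hx, rfl⟩ := Finset.mem_image.1 (Finset.mem_coe.1 ha)
  obtain ⟨y, hy, rfl⟩ := Finset.mem_image.1 (Finset.mem_coe.1 hb)
  exact hclique x hx y hy fun hxy => hab (hxy ▸ rfl)

theorem adj_of_forall_exists_not_adj (hP5 : IsFree G (pathGraph 5))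
    (h : IsPrivateSystem G D D p) (hnonuniv : ∀ x ∈ D, ∃ t ∈ D, t ≠ x ∧ ¬ G.Adj t x) :
    ∀ x ∈ D, ∀ y ∈ D, x ≠ y → G.Adj (p x) (p y) := by
  intro x hx z hz hne
  by_contra hxz
  have hxz' : G.Adj x z := by
    by_contra hn
    exact hxz (h.adj_of_not_adj hP5 hx hz hne hn)
  obtain ⟨u, hu, hux, hadj⟩ := hnonuniv x hx
  obtain ⟨t, ht, htz, hadj'⟩ := hnonuniv z hz
  have hnbr : ∀ w ∈ D, G.Adj x w → w = z := fun w hw hxw =>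
    h.eq_of_adj_of_not_adj hP5 hx hz hu hxz hne hux hadj hw hxw
  have htx : t ≠ x := by
    rintro rfl
    exact hadj' hxz'
  obtain h1 | h1 := h.adj_or_adj hP5 hx hz ht hxz' htx htz
  · exact htz (hnbr t ht h1)
  · exact hadj' h1.symm

theorem adj_of_universal [DecidableEq V] (hP5 : IsFree G (pathGraph 5)) {c : V}
    (h : IsPrivateSystem G D (D.erase c) p) (hc : c ∈ D) (huniv : ∀ y ∈ D, y ≠ c → G.Adj c y)
    {a b : V} (ha : a ∈ D.erase c) (hb : b ∈ D.erase c) (hab : a ≠ b) (hadj : ¬ G.Adj a b) :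
    ∀ x ∈ D.erase c, ∀ y ∈ D.erase c, x ≠ y → G.Adj (p x) (p y) := by
  have key : ∀ x ∈ D.erase c, ∀ z ∈ D.erase c, x ≠ z → ¬ G.Adj (p x) (p z) →
      ∀ u ∈ D.erase c, u ≠ x → G.Adj u x := by
    intro x hx z hz hne hxz u hu hux
    by_contra hn
    exact Finset.ne_of_mem_erase hz (h.eq_of_adj_of_not_adj hP5 hx hz hu hxz hne hux hn hc
      (huniv x (h.subset hx) (Finset.ne_of_mem_erase hx)).symm).symm
  have hpa : ∀ x ∈ D.erase c, a ≠ x → G.Adj (p a) (p x) := by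
    intro x hx hax
    by_contra hn
    exact hadj (key a ha x hx hax hn b hb hab.symm).symm
  intro x hx z hz hne
  by_contra hxz
  have hax : a ≠ x := by
    rintro rfl
    exact hxz (hpa z hz hne)
  have haz : a ≠ z := by
    rintro rfl
    exact hxz (hpa x hx hne.symm).symm
  exact Finset.ne_of_mem_erase hz (h.eq_of_not_adj hP5 hx hz ha hxz hne (hpa x hx hax)
    (hpa z hz haz).symm hc (huniv x (h.subset hx) (Finset.ne_of_mem_erase hx)).symm
    (Finset.ne_of_mem_erase ha).symm hax).symm

end IsPrivateSystem

theorem domNum_le_of_isFree [Fintype V] {G : SimpleGraph V} (hconn : G.Connected) {r : ℕ}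
    (hKr : IsFree G (⊤ : SimpleGraph (Fin r))) (hP5 : IsFree G (pathGraph 5)) :
    domNum G ≤ r := by
  classical
  obtain ⟨D, hD, hmin⟩ := exists_minimal_isConnDomSet hconn
  refine hD.isDomSet.domNum_le.trans ?_
  have hdiam : ∀ x ∈ D, ∀ y ∈ D, x = y ∨ G.Adj x y ∨ ∃ m ∈ D, G.Adj x m ∧ G.Adj m y :=
    fun x hx y hy => exists_common_neighbor hP5 hD hmin hx hy
  by_cases huniv : ∃ c ∈ D, ∀ y ∈ D, y ≠ c → G.Adj c y
  · obtain ⟨c, hc, huniv⟩ := huniv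
    have hpriv : ∀ x, ∃ x', x ∈ D.erase c → IsPrivateNeighbor G D x x' := by
      intro x
      by_cases hx : x ∈ D.erase c
      · obtain ⟨x', hx'⟩ := exists_isPrivateNeighbor_of_universal hD hmin hc huniv
          (Finset.mem_of_mem_erase hx) (Finset.ne_of_mem_erase hx)
        exact ⟨x', fun _ => hx'⟩
      · exact ⟨x, fun h => absurd h hx⟩
    choose p hp using hpriv
    have hsys : IsPrivateSystem G D (D.erase c) p := ⟨hdiam, Finset.erase_subset c D, hp⟩
    by_cases hclique : ∃ a ∈ D.erase c, ∃ b ∈ D.erase c, a ≠ b ∧ ¬ G.Adj a b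
    · obtain ⟨a, ha, b, hb, hab, hadj⟩ := hclique
      have := hsys.card_lt hKr (hsys.adj_of_universal hP5 hc huniv ha hb hab hadj)
      rw [Finset.card_erase_of_mem hc] at this
      omega
    · push Not at hclique
      refine (hKr.card_lt_of_isClique fun a ha b hb hab => ?_).le
      rw [Finset.mem_coe] at ha hb
      by_cases hac : a = c
      · subst hac
        exact huniv b hb hab.symm
      by_cases hbc : b = c
      · subst hbc
        exact (huniv a ha hab).symm
      exact hclique a (Finset.mem_erase.2 ⟨hac, ha⟩) b (Finset.mem_erase.2 ⟨hbc, hb⟩) hab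
  · have hnonuniv : ∀ x ∈ D, ∃ t ∈ D, t ≠ x ∧ ¬ G.Adj t x := by
      push Not at huniv
      intro x hx
      obtain ⟨t, ht, htx, hadj⟩ := huniv x hx
      exact ⟨t, ht, htx, fun e => hadj e.symm⟩
    have hpriv : ∀ x, ∃ x', x ∈ D → IsPrivateNeighbor G D x x' := by
      intro x
      by_cases hx : x ∈ D
      · obtain ⟨t, ht, htx, hadj⟩ := hnonuniv x hx
        obtain ⟨x', hx'⟩ := exists_isPrivateNeighbor_of_not_adj hP5 hD hmin hx ht htx hadj
        exact ⟨x', fun _ => hx'⟩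
      · exact ⟨x, fun h => absurd h hx⟩
    choose p hp using hpriv
    have hsys : IsPrivateSystem G D D p := ⟨hdiam, Finset.Subset.refl D, hp⟩
    exact (hsys.card_lt hKr (hsys.adj_of_forall_exists_not_adj hP5 hnonuniv)).le

theorem domNum_le_one_of_isFree_two [Fintype V] {G : SimpleGraph V} (hconn : G.Connected)
    (hK2 : IsFree G (⊤ : SimpleGraph (Fin 2))) : domNum G ≤ 1 := by
  classical
  have hempty : ∀ a b, ¬ G.Adj a b := by
    intro a b hab
    have hK : G.IsClique (({a, b} : Finset V) : Set V) := by
      simpa using fun _ => hab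
    have := hK2.card_lt_of_isClique hK
    rw [Finset.card_pair hab.ne] at this
    omega
  obtain ⟨v⟩ := hconn.nonempty
  have hdom : IsDomSet G {v} := by
    intro w
    obtain ⟨q⟩ := hconn w v
    cases q with
    | nil => simp
    | cons hadj _ => exact absurd hadj (hempty _ _)
  simpa using hdom.domNum_le

end

theorem stmt_5 {V W : Type*} [Fintype V] [Fintype W] (G : SimpleGraph V) (hconn : G.Connected)
    (r : ℕ) (hr : 1 < r)
    (hKr : IsFree G (⊤ : SimpleGraph (Fin r)))
    (hP5 : IsFree G (pathGraph 5)) (H : SimpleGraph W) :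
    (((r : ℝ) - 1) / (2 * r - 3)) * domNum G * domNum H ≤ domNum (G □ H) := by
  have hne : Nonempty V := hconn.nonempty
  have hG : domNum G + 3 ≤ 2 * r := by
    obtain rfl | hr3 : r = 2 ∨ 3 ≤ r := by omega
    · have := domNum_le_one_of_isFree_two hconn hKr
      omega
    · have := domNum_le_of_isFree hconn hKr hP5
      omega
  have hGH := domNum_mul_domNum_succ_le G H
  rify at hG hGH
  have hpos : (0 : ℝ) < 2 * r - 3 := by
    have : (2 : ℝ) ≤ r := by exact_mod_cast hr
    linarith
  rw [div_mul_eq_mul_div, div_mul_eq_mul_div, div_le_iff₀ hpos]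
  have hH : (0 : ℝ) ≤ domNum H := Nat.cast_nonneg _
  nlinarith [mul_le_mul_of_nonneg_right hGH hpos.le,
    mul_nonneg hH (sub_nonneg.2 hG)]
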